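/- Let μ_f, μ_m > 0, F* > 0 and let d < 0 (representing λ'(F*) for the decreasing egg-laying rate λ). Then every complex root Λ of the quadratic equation Λ² + (2 μ_f μ_m − d F* μ_f) Λ − d F* (μ_f + μ_m) μ_f μ_m = 0 has negative real part. -/

import Mathlib

/-!
STATEMENT 4: Every complex root of the characteristic equation
`Λ² + (2 μ_f μ_m − d F* μ_f) Λ − d F* (μ_f + μ_m) μ_f μ_m = 0`
(with `d = λ'(F*) < 0`) has negative real part.
-/

theorem characteristic_roots_negative_real_part
    (μf μm Fstar d : ℝ)
    (hμf : 0 < μf) (hμm : 0 < μm) (hFstar : 0 < Fstar) (hd : d < 0)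
    (Λ : ℂ)
    (hroot : Λ ^ 2 + ((2 * μf * μm - d * Fstar * μf : ℝ) : ℂ) * Λ -
      ((d * Fstar * (μf + μm) * μf * μm : ℝ) : ℂ) = 0) :
    Λ.re < 0 := by
  have hdF : 0 < -d * Fstar := mul_pos (by linarith) hFstar
  have hb : 0 < 2 * μf * μm - d * Fstar * μf := by
    have h1 := mul_pos hμf hμm
    have h2 := mul_pos hdF hμf
    linarith
  have hc : 0 < -(d * Fstar * (μf + μm) * μf * μm) := by
    have h := mul_pos (mul_pos (mul_pos hdF (add_pos hμf hμm)) hμf) hμm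
    linarith
  generalize 2 * μf * μm - d * Fstar * μf = b at *
  generalize d * Fstar * (μf + μm) * μf * μm = c at *
  have hre := congrArg Complex.re hroot
  have him := congrArg Complex.im hroot
  simp [pow_two] at hre him
  by_contra hx
  have hx' : 0 ≤ Λ.re := not_lt.mp hx
  have hy : Λ.im * (2 * Λ.re + b) = 0 := by linarith
  have hy0 : Λ.im = 0 := by
    rcases mul_eq_zero.mp hy with h | h
    · exact h
    · linarith
  rw [hy0] at hre
  nlinarith [mul_nonneg hb.le hx', mul_nonneg hx' hx']
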